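/- For the same f_N, the Whitney-supremum Carleson bound holds: C(W_∞ f_N)(x) ≲ N for all x ∈ [0,1], where W_∞ denotes the supremum over Whitney regions. Combined with the lower bound C(H f_N) ≳ N² on (0,1), this shows the horizontally acting Hilbert transform is unbounded in the norms ‖C(W_q f)‖_p for all 1 < p, q < ∞. -/

import Mathlib

open MeasureTheory Set
open scoped ENNReal Classical

noncomputable section

/-- The function
`f_N(t,x) = ∑_{j=0}^N ∑_{k=2^j}^{2^{j+1}-1} 2^k 1_{(2^{-k},2^{1-k})}(t) 1_{(k2^{-j}-1,(k+1)2^{-j}-1)}(x)`. -/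
def fH (N : ℕ) (w : ℝ × ℝ) : ℝ :=
  ∑ j ∈ Finset.range (N + 1), ∑ k ∈ Finset.Ico (2 ^ j) (2 ^ (j + 1)),
    if w.1 ∈ Set.Ioo ((2 : ℝ) ^ (-(k : ℤ))) ((2 : ℝ) ^ (1 - (k : ℤ))) ∧
       w.2 ∈ Set.Ioo ((k : ℝ) * 2 ^ (-(j : ℤ)) - 1) (((k : ℝ) + 1) * 2 ^ (-(j : ℤ)) - 1)
    then (2 : ℝ) ^ k else 0

/-- The Whitney box `(t/2, t) × (x - t/2, x + t/2)` in `ℝ²₊`. -/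
def wBox (p : ℝ × ℝ) : Set (ℝ × ℝ) :=
  Set.Ioo (p.1 / 2) p.1 ×ˢ Set.Ioo (p.2 - p.1 / 2) (p.2 + p.1 / 2)

/-- The Whitney `L^∞` average (essential supremum over the Whitney region). -/
def wInf (f : ℝ × ℝ → ℝ) (p : ℝ × ℝ) : ℝ≥0∞ :=
  essSup (fun z => ENNReal.ofReal |f z|) (volume.restrict (wBox p))

/-- The Whitney `L^q` average. -/
def wLq (q : ℝ) (f : ℝ × ℝ → ℝ) (p : ℝ × ℝ) : ℝ≥0∞ :=
  ((ENNReal.ofReal (p.1 / 2 * p.1))⁻¹ *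
      ∫⁻ z in wBox p, ENNReal.ofReal |f z| ^ q) ^ (1 / q)

/-- The Carleson functional on `ℝ²₊`, `Cg(x) = sup_{Q ∋ x} |Q|⁻¹ ∫_{Q^{ca}} g`. -/
def carlE (g : ℝ × ℝ → ℝ≥0∞) (x : ℝ) : ℝ≥0∞ :=
  ⨆ (a : ℝ) (ℓ : ℝ) (_ : 0 < ℓ) (_ : x ∈ Set.Ico a (a + ℓ)),
    (ENNReal.ofReal ℓ)⁻¹ * ∫⁻ w in Set.Ioo 0 ℓ ×ˢ Set.Ico a (a + ℓ), g w

/-- A majorant of `fH N` over Whitney boxes: each rectangle of `fH N` is enlarged upwards by a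
factor `2` and sideways by two of its own lengths. -/
def fMaj (N : ℕ) (p : ℝ × ℝ) : ℝ≥0∞ :=
  ∑ j ∈ Finset.range (N + 1), ∑ k ∈ Finset.Ico ((2 : ℤ) ^ j) (2 ^ (j + 1)),
    (Set.Ioo ((2 : ℝ) ^ (-k)) ((2 : ℝ) ^ (2 - k))).indicator
        (fun _ => ENNReal.ofReal (2 ^ k)) p.1 *
      (Set.Ioo (((k : ℝ) - 2) * 2 ^ (-(j : ℤ)) - 1)
        (((k : ℝ) + 3) * 2 ^ (-(j : ℤ)) - 1)).indicator (fun _ => 1) p.2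

lemma two_zpow_neg_le_of_two_pow_le {j : ℕ} {k : ℤ} (h : 2 ^ j ≤ k) :
    (2 : ℝ) ^ (-k) ≤ 2 ^ (-(j : ℤ)) := by
  apply zpow_le_zpow_right₀ (by norm_num)
  have : (j : ℤ) < 2 ^ j := by exact_mod_cast Nat.lt_two_pow_self (n := j)
  linarith

lemma ofReal_abs_fH_le_fMaj {N : ℕ} {p z : ℝ × ℝ} (hz : z ∈ wBox p) :
    ENNReal.ofReal |fH N z| ≤ fMaj N p := by
  obtain ⟨⟨h1, h2⟩, h3, h4⟩ := hz
  have hnn : ∀ (j : ℕ) (k : ℤ), 0 ≤ (if z.1 ∈ Set.Ioo ((2 : ℝ) ^ (-k)) ((2 : ℝ) ^ (1 - k)) ∧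
       z.2 ∈ Set.Ioo ((k : ℝ) * 2 ^ (-(j : ℤ)) - 1) (((k : ℝ) + 1) * 2 ^ (-(j : ℤ)) - 1)
    then (2 : ℝ) ^ k else 0) := fun j k => by split_ifs <;> positivity
  unfold fH fMaj
  rw [abs_of_nonneg (Finset.sum_nonneg fun j _ => Finset.sum_nonneg fun k _ => hnn j k),
    ENNReal.ofReal_sum_of_nonneg fun j _ => Finset.sum_nonneg fun k _ => hnn j k]
  refine Finset.sum_le_sum fun j _ => ?_
  rw [ENNReal.ofReal_sum_of_nonneg fun k _ => hnn j k]
  refine Finset.sum_le_sum fun k hk => ?_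
  split_ifs with h
  · obtain ⟨⟨h5, h6⟩, h7, h8⟩ := h
    have hjk := two_zpow_neg_le_of_two_pow_le (Finset.mem_Ico.1 hk).1
    rw [zpow_sub₀ two_ne_zero, zpow_one, div_eq_mul_inv, ← zpow_neg] at h6
    have e2 : (2 : ℝ) ^ (2 - k) = 4 * 2 ^ (-k) := by
      rw [sub_eq_add_neg, zpow_add₀ two_ne_zero]; norm_num
    rw [Set.indicator_of_mem, Set.indicator_of_mem, mul_one]
    · constructor <;> nlinarith
    · rw [e2]; constructor <;> linarith
  · simp

lemma wInf_fH_le_fMaj (N : ℕ) (p : ℝ × ℝ) : wInf (fH N) p ≤ fMaj N p := by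
  refine essSup_le_of_ae_le _ ?_
  filter_upwards [ae_restrict_mem (measurableSet_Ioo.prod measurableSet_Ioo)] with z hz
  exact ofReal_abs_fH_le_fMaj hz

lemma volume_wBox {p : ℝ × ℝ} (hp : 0 < p.1) :
    volume (wBox p) = ENNReal.ofReal (p.1 / 2 * p.1) := by
  rw [wBox, Measure.volume_eq_prod, Measure.prod_prod, Real.volume_Ioo, Real.volume_Ioo,
    ← ENNReal.ofReal_mul (by linarith)]
  congr 1; ring

lemma wLq_le_of_forall_le {q : ℝ} (hq : 0 < q) {f : ℝ × ℝ → ℝ} {p : ℝ × ℝ} (hp : 0 < p.1)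
    {M : ℝ≥0∞} (h : ∀ z ∈ wBox p, ENNReal.ofReal |f z| ≤ M) : wLq q f p ≤ M := by
  have h0 : ENNReal.ofReal (p.1 / 2 * p.1) ≠ 0 := by
    rw [ENNReal.ofReal_ne_zero_iff]; positivity
  have hI : ∫⁻ z in wBox p, ENNReal.ofReal |f z| ^ q ≤ M ^ q * ENNReal.ofReal (p.1 / 2 * p.1) := by
    rw [← volume_wBox hp, ← setLIntegral_const]
    exact setLIntegral_mono' (measurableSet_Ioo.prod measurableSet_Ioo)
      fun z hz => ENNReal.rpow_le_rpow (h z hz) hq.le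
  calc wLq q f p ≤ ((ENNReal.ofReal (p.1 / 2 * p.1))⁻¹ *
        (M ^ q * ENNReal.ofReal (p.1 / 2 * p.1))) ^ (1 / q) := by
        unfold wLq; gcongr
    _ = M := by
      rw [mul_comm, mul_assoc, ENNReal.mul_inv_cancel h0 ENNReal.ofReal_ne_top, mul_one,
        ← ENNReal.rpow_mul, mul_one_div_cancel hq.ne', ENNReal.rpow_one]

lemma sum_indicator_Ioo_le (j : ℕ) (y : ℝ) :
    ∑ k ∈ Finset.Ico ((2 : ℤ) ^ j) (2 ^ (j + 1)),
      (Set.Ioo (((k : ℝ) - 2) * 2 ^ (-(j : ℤ)) - 1)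
        (((k : ℝ) + 3) * 2 ^ (-(j : ℤ)) - 1)).indicator (fun _ => (1 : ℝ≥0∞)) y
      ≤ 5 * (Set.Ioo (-2 : ℝ) 3).indicator (fun _ => 1) y := by
  have hε : (0 : ℝ) < 2 ^ (-(j : ℤ)) := by positivity
  have hε1 : (2 : ℝ) ^ (-(j : ℤ)) ≤ 1 := zpow_le_one_of_nonpos₀ (by norm_num) (by simp)
  have hmul : (2 : ℝ) ^ j * 2 ^ (-(j : ℤ)) = 1 := by
    rw [zpow_neg, zpow_natCast]; exact mul_inv_cancel₀ (by positivity)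
  set ε : ℝ := (2 : ℝ) ^ (-(j : ℤ)) with hεdef
  by_cases hy : y ∈ Set.Ioo (-2 : ℝ) 3
  · rw [Set.indicator_of_mem hy, mul_one]
    simp only [Set.indicator_apply]
    rw [Finset.sum_boole]
    have hcard : (Finset.filter (fun k : ℤ => y ∈ Set.Ioo (((k : ℝ) - 2) * ε - 1)
        (((k : ℝ) + 3) * ε - 1)) (Finset.Ico ((2 : ℤ) ^ j) (2 ^ (j + 1)))).card ≤ 5 := by
      have h5 : (Finset.Icc (⌊(y + 1) * 2 ^ j⌋ - 2) (⌊(y + 1) * 2 ^ j⌋ + 2)).card = 5 := by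
        rw [Int.card_Icc]; omega
      rw [← h5]
      refine Finset.card_le_card fun k hk => ?_
      obtain ⟨-, h1, h2⟩ := Finset.mem_filter.1 hk
      have hj : (0 : ℝ) < 2 ^ j := by positivity
      have h1' : (k : ℝ) - 2 < (y + 1) * 2 ^ j := by
        have := mul_lt_mul_of_pos_right (sub_lt_iff_lt_add.1 h1) hj
        rwa [mul_assoc, mul_comm ε, hmul, mul_one] at this
      have h2' : (y + 1) * 2 ^ j < (k : ℝ) + 3 := by
        have := mul_lt_mul_of_pos_right (lt_sub_iff_add_lt.1 h2) hj
        rwa [mul_assoc, mul_comm ε, hmul, mul_one] at this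
      have h3 := Int.floor_le ((y + 1) * 2 ^ j)
      have h4 := Int.lt_floor_add_one ((y + 1) * 2 ^ j)
      have h6 : (k : ℝ) < ((⌊(y + 1) * 2 ^ j⌋ + 3 : ℤ) : ℝ) := by push_cast; linarith
      have h7 : ((⌊(y + 1) * 2 ^ j⌋ : ℤ) : ℝ) < ((k + 3 : ℤ) : ℝ) := by push_cast; linarith
      have h6' := Int.cast_lt.1 h6
      have h7' := Int.cast_lt.1 h7
      rw [Finset.mem_Icc]
      constructor <;> omega
    exact_mod_cast hcard
  · rw [Set.indicator_of_notMem hy, mul_zero]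
    refine (Finset.sum_eq_zero fun k hk => Set.indicator_of_notMem ?_ _).le
    rintro ⟨h1, h2⟩
    obtain ⟨hk1, hk2⟩ := Finset.mem_Ico.1 hk
    have hk1' : (2 : ℝ) ^ j ≤ k := by exact_mod_cast hk1
    have hk2' : (k : ℝ) + 1 ≤ 2 * 2 ^ j := by
      rw [pow_succ] at hk2
      have : k + 1 ≤ 2 * 2 ^ j := by linarith
      exact_mod_cast this
    refine hy ⟨?_, ?_⟩ <;> nlinarith

lemma lintegral_fMaj_le (N : ℕ) (ℓ : ℝ) (I : Set ℝ) :
    ∫⁻ w in Set.Ioo 0 ℓ ×ˢ I, fMaj N w ≤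
      15 * ((N : ℝ≥0∞) + 1) * volume (Set.Ioo (-2 : ℝ) 3 ∩ I) := by
  have hm : ∀ (j : ℕ) (k : ℤ), Measurable ((Set.Ioo (((k : ℝ) - 2) * 2 ^ (-(j : ℤ)) - 1)
        (((k : ℝ) + 3) * 2 ^ (-(j : ℤ)) - 1)).indicator (fun _ => (1 : ℝ≥0∞))) :=
    fun j k => measurable_const.indicator measurableSet_Ioo
  have hm' : ∀ k : ℤ, Measurable
      ((Set.Ioo ((2 : ℝ) ^ (-k)) ((2 : ℝ) ^ (2 - k))).indicator
        (fun _ => ENNReal.ofReal (2 ^ k))) :=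
    fun k => measurable_const.indicator measurableSet_Ioo
  have hmm : ∀ (j : ℕ) (k : ℤ), Measurable fun p : ℝ × ℝ =>
      (Set.Ioo ((2 : ℝ) ^ (-k)) ((2 : ℝ) ^ (2 - k))).indicator
        (fun _ => ENNReal.ofReal (2 ^ k)) p.1 *
      (Set.Ioo (((k : ℝ) - 2) * 2 ^ (-(j : ℤ)) - 1)
        (((k : ℝ) + 3) * 2 ^ (-(j : ℤ)) - 1)).indicator (fun _ => 1) p.2 :=
    fun j k => ((hm' k).comp measurable_fst).mul ((hm j k).comp measurable_snd)
  have h3 : ∀ k : ℤ, ∫⁻ t in Set.Ioo 0 ℓ, (Set.Ioo ((2 : ℝ) ^ (-k))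
      ((2 : ℝ) ^ (2 - k))).indicator (fun _ => ENNReal.ofReal (2 ^ k)) t ≤ 3 := by
    intro k
    refine (setLIntegral_le_lintegral _ _).trans ?_
    rw [lintegral_indicator_const measurableSet_Ioo, Real.volume_Ioo,
      ← ENNReal.ofReal_mul (by positivity)]
    have : (2 : ℝ) ^ k * (2 ^ (2 - k) - 2 ^ (-k)) = 3 := by
      rw [sub_eq_add_neg 2 k, zpow_add₀ two_ne_zero, zpow_neg]
      field_simp; norm_num
    rw [this]; simp
  unfold fMaj
  rw [Measure.volume_eq_prod, ← Measure.prod_restrict]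
  rw [lintegral_finsetSum _ fun j _ => Finset.measurable_sum _ fun k _ => hmm j k]
  calc _ ≤ ∑ j ∈ Finset.range (N + 1), 15 * volume (Set.Ioo (-2 : ℝ) 3 ∩ I) := by
        refine Finset.sum_le_sum fun j _ => ?_
        rw [lintegral_finsetSum _ fun k _ => hmm j k]
        calc _ ≤ ∑ k ∈ Finset.Ico ((2 : ℤ) ^ j) (2 ^ (j + 1)), 3 * ∫⁻ y in I,
              (Set.Ioo (((k : ℝ) - 2) * 2 ^ (-(j : ℤ)) - 1)
                (((k : ℝ) + 3) * 2 ^ (-(j : ℤ)) - 1)).indicator (fun _ => (1 : ℝ≥0∞)) y := by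
              refine Finset.sum_le_sum fun k _ => ?_
              rw [lintegral_prod_mul (hm' k).aemeasurable (hm j k).aemeasurable]
              gcongr
              exact h3 k
          _ ≤ 3 * ∫⁻ y in I, 5 * (Set.Ioo (-2 : ℝ) 3).indicator (fun _ => 1) y := by
              rw [← Finset.mul_sum, ← lintegral_finsetSum _ fun k _ => hm j k]
              gcongr with y
              exact sum_indicator_Ioo_le j y
          _ = 15 * volume (Set.Ioo (-2 : ℝ) 3 ∩ I) := by
              rw [lintegral_const_mul _ (measurable_const.indicator measurableSet_Ioo),
                lintegral_indicator_const measurableSet_Ioo, one_mul,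
                Measure.restrict_apply measurableSet_Ioo, ← mul_assoc]
              norm_num
    _ = _ := by
        rw [Finset.sum_const, Finset.card_range, nsmul_eq_mul]; push_cast; ring

lemma volume_Ioo_inter_Ico_le {a ℓ x : ℝ} (hℓ : 0 < ℓ) (hx : x ∈ Set.Ico a (a + ℓ)) :
    volume (Set.Ioo (-2 : ℝ) 3 ∩ Set.Ico a (a + ℓ)) ≤
      ENNReal.ofReal ℓ * ENNReal.ofReal (9 * (1 + |x|)⁻¹) := by
  rw [← ENNReal.ofReal_mul hℓ.le]
  have hpos : 0 < 1 + |x| := by positivity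
  obtain ⟨hx1, hx2⟩ := hx
  rcases le_total |x| 8 with h8 | h8
  · refine (measure_mono Set.inter_subset_right).trans ?_
    rw [Real.volume_Ico]
    apply ENNReal.ofReal_le_ofReal
    have : 1 ≤ 9 * (1 + |x|)⁻¹ := by
      rw [← div_eq_mul_inv, le_div_iff₀ hpos]; linarith
    nlinarith
  · rcases (Set.Ioo (-2 : ℝ) 3 ∩ Set.Ico a (a + ℓ)).eq_empty_or_nonempty with he | ⟨y, hy, hy'⟩
    · simp [he]
    · refine (measure_mono Set.inter_subset_left).trans ?_
      rw [Real.volume_Ioo]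
      apply ENNReal.ofReal_le_ofReal
      have hl : |x| - 3 ≤ ℓ := by
        obtain ⟨h1, h2⟩ := hy
        obtain ⟨h3, h4⟩ := hy'
        rcases abs_cases x with ⟨h, _⟩ | ⟨h, _⟩ <;> rw [h] <;> linarith
      rw [← mul_assoc, ← div_eq_mul_inv, le_div_iff₀ hpos]
      nlinarith

lemma carlE_le_of_le_fMaj {N : ℕ} {g : ℝ × ℝ → ℝ≥0∞} (hg : ∀ w, 0 < w.1 → g w ≤ fMaj N w)
    (x : ℝ) : carlE g x ≤ ENNReal.ofReal (135 * ((N : ℝ) + 1)) * ENNReal.ofReal ((1 + |x|)⁻¹) := by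
  refine iSup_le fun a => iSup_le fun ℓ => iSup_le fun hℓ => iSup_le fun hx => ?_
  have h0 : ENNReal.ofReal ℓ ≠ 0 := by rwa [ENNReal.ofReal_ne_zero_iff]
  rw [ENNReal.inv_mul_le_iff h0 ENNReal.ofReal_ne_top]
  calc ∫⁻ w in Set.Ioo 0 ℓ ×ˢ Set.Ico a (a + ℓ), g w
      ≤ ∫⁻ w in Set.Ioo 0 ℓ ×ˢ Set.Ico a (a + ℓ), fMaj N w :=
        setLIntegral_mono' (measurableSet_Ioo.prod measurableSet_Ico) fun w hw => hg w hw.1.1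
    _ ≤ _ := lintegral_fMaj_le N ℓ _
    _ ≤ 15 * ((N : ℝ≥0∞) + 1) * (ENNReal.ofReal ℓ * ENNReal.ofReal (9 * (1 + |x|)⁻¹)) := by
        gcongr; exact volume_Ioo_inter_Ico_le hℓ hx
    _ = _ := by
        rw [ENNReal.ofReal_mul (by norm_num), ENNReal.ofReal_mul (by norm_num),
          ENNReal.ofReal_add (by positivity) (by norm_num)]
        simp only [ENNReal.ofReal_natCast, ENNReal.ofReal_one, ENNReal.ofReal_ofNat]
        ring

lemma average_le_wLq {q : ℝ} (hq : 1 ≤ q) {h : ℝ × ℝ → ℝ} (hm : Measurable h) {p : ℝ × ℝ}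
    (hp : 0 < p.1) :
    (ENNReal.ofReal (p.1 / 2 * p.1))⁻¹ * ∫⁻ z in wBox p, ENNReal.ofReal |h z| ≤ wLq q h p := by
  have h0 : ENNReal.ofReal (p.1 / 2 * p.1) ≠ 0 := by
    rw [ENNReal.ofReal_ne_zero_iff]; positivity
  let μ : Measure (ℝ × ℝ) := (ENNReal.ofReal (p.1 / 2 * p.1))⁻¹ • volume.restrict (wBox p)
  have : IsProbabilityMeasure μ := ⟨by
    simp only [μ, Measure.smul_apply, Measure.restrict_apply_univ, volume_wBox hp, smul_eq_mul]
    exact ENNReal.inv_mul_cancel h0 ENNReal.ofReal_ne_top⟩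
  have key := eLpNorm'_le_eLpNorm'_of_exponent_le one_pos hq μ hm.aestronglyMeasurable
  simpa [eLpNorm', μ, wLq, Real.enorm_eq_ofReal_abs, lintegral_smul_measure] using key

lemma one_half_le_lintegral_wBox {s y a ℓ : ℝ} (hs : s ∈ Set.Ioo 0 ℓ)
    (hy : y ∈ Set.Ico a (a + ℓ)) :
    (1 / 2 : ℝ≥0∞) ≤ ∫⁻ p in Set.Ioo 0 (4 * ℓ) ×ˢ Set.Ico (a - ℓ) (a - ℓ + 4 * ℓ),
      (ENNReal.ofReal (p.1 / 2 * p.1))⁻¹ * (wBox p).indicator (fun _ => 1) (s, y) := by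
  obtain ⟨hs0, hsl⟩ := hs
  obtain ⟨hy1, hy2⟩ := hy
  set R : Set (ℝ × ℝ) := Set.Ioo s (2 * s) ×ˢ Set.Ioo (y - s / 2) (y + s / 2)
  have hRm : MeasurableSet R := measurableSet_Ioo.prod measurableSet_Ioo
  calc (1 / 2 : ℝ≥0∞) = ∫⁻ _ in R, (ENNReal.ofReal (2 * s * s))⁻¹ := by
        rw [setLIntegral_const, Measure.volume_eq_prod, Measure.prod_prod, Real.volume_Ioo,
          Real.volume_Ioo, ← ENNReal.ofReal_mul (by linarith),
          ← ENNReal.ofReal_inv_of_pos (by positivity), ← ENNReal.ofReal_mul (by positivity)]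
        have : (2 * s * s)⁻¹ * ((2 * s - s) * (y + s / 2 - (y - s / 2))) = 1 / 2 := by
          field_simp; ring
        rw [this, ENNReal.ofReal_div_of_pos (by norm_num)]; simp
    _ ≤ ∫⁻ p in R, (ENNReal.ofReal (p.1 / 2 * p.1))⁻¹ *
          (wBox p).indicator (fun _ => 1) (s, y) := by
        refine setLIntegral_mono' hRm fun p hp => ?_
        obtain ⟨⟨h1, h2⟩, h3, h4⟩ := hp
        rw [Set.indicator_of_mem, mul_one]
        · refine ENNReal.inv_le_inv.2 (ENNReal.ofReal_le_ofReal ?_)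
          nlinarith
        · refine ⟨⟨?_, ?_⟩, ?_, ?_⟩ <;> dsimp only <;> linarith
    _ ≤ _ := by
        refine lintegral_mono_set ?_
        rintro p ⟨⟨h1, h2⟩, h3, h4⟩
        refine ⟨⟨?_, ?_⟩, ?_, ?_⟩ <;> linarith

lemma measurable_indicator_wBox :
    Measurable fun r : (ℝ × ℝ) × (ℝ × ℝ) => (wBox r.1).indicator (fun _ => (1 : ℝ≥0∞)) r.2 := by
  have hS : MeasurableSet {r : (ℝ × ℝ) × (ℝ × ℝ) | r.2 ∈ wBox r.1} := by
    have : {r : (ℝ × ℝ) × (ℝ × ℝ) | r.2 ∈ wBox r.1} =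
        ({r | r.1.1 / 2 < r.2.1} ∩ {r | r.2.1 < r.1.1}) ∩
        ({r | r.1.2 - r.1.1 / 2 < r.2.2} ∩ {r | r.2.2 < r.1.2 + r.1.1 / 2}) := rfl
    rw [this]
    refine ((measurableSet_lt ?_ ?_).inter (measurableSet_lt ?_ ?_)).inter
      ((measurableSet_lt ?_ ?_).inter (measurableSet_lt ?_ ?_)) <;> fun_prop
  exact (measurable_const (a := (1 : ℝ≥0∞))).indicator hS

lemma lintegral_le_two_mul_lintegral_wLq {q : ℝ} (hq : 1 ≤ q) {h : ℝ × ℝ → ℝ} (hm : Measurable h)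
    (a ℓ : ℝ) :
    ∫⁻ z in Set.Ioo 0 ℓ ×ˢ Set.Ico a (a + ℓ), ENNReal.ofReal |h z| ≤
      2 * ∫⁻ p in Set.Ioo 0 (4 * ℓ) ×ˢ Set.Ico (a - ℓ) (a - ℓ + 4 * ℓ), wLq q h p := by
  set Q := Set.Ioo 0 ℓ ×ˢ Set.Ico a (a + ℓ)
  set Q' := Set.Ioo 0 (4 * ℓ) ×ˢ Set.Ico (a - ℓ) (a - ℓ + 4 * ℓ)
  have hg : Measurable fun z => ENNReal.ofReal |h z| := by fun_prop
  have hQ : MeasurableSet Q := measurableSet_Ioo.prod measurableSet_Ico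
  have hQ' : MeasurableSet Q' := measurableSet_Ioo.prod measurableSet_Ico
  have hw : Measurable fun p : ℝ × ℝ => (ENNReal.ofReal (p.1 / 2 * p.1))⁻¹ := by fun_prop
  have hK : Measurable fun r : (ℝ × ℝ) × (ℝ × ℝ) =>
      (ENNReal.ofReal (r.1.1 / 2 * r.1.1))⁻¹ * (wBox r.1).indicator (fun _ => 1) r.2 :=
    (hw.comp measurable_fst).mul measurable_indicator_wBox
  calc ∫⁻ z in Q, ENNReal.ofReal |h z|
      = 2 * ∫⁻ z in Q, ENNReal.ofReal |h z| * (1 / 2) := by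
        rw [lintegral_mul_const _ hg, mul_comm, mul_assoc, one_div,
          ENNReal.inv_mul_cancel (by norm_num) (by norm_num), mul_one]
    _ ≤ 2 * ∫⁻ z in Q, ENNReal.ofReal |h z| * ∫⁻ p in Q',
          (ENNReal.ofReal (p.1 / 2 * p.1))⁻¹ * (wBox p).indicator (fun _ => 1) z := by
        refine mul_le_mul_right (setLIntegral_mono' hQ fun z hz => ?_) _
        exact mul_le_mul_right (one_half_le_lintegral_wBox hz.1 hz.2) _
    _ ≤ 2 * ∫⁻ z, ∫⁻ p in Q', ENNReal.ofReal |h z| *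
          ((ENNReal.ofReal (p.1 / 2 * p.1))⁻¹ * (wBox p).indicator (fun _ => 1) z) := by
        refine mul_le_mul_right ((setLIntegral_le_lintegral _ _).trans_eq ?_) _
        refine lintegral_congr fun z => ?_
        exact (lintegral_const_mul _ (hK.comp measurable_prodMk_right)).symm
    _ = 2 * ∫⁻ p in Q', ∫⁻ z, ENNReal.ofReal |h z| *
          ((ENNReal.ofReal (p.1 / 2 * p.1))⁻¹ * (wBox p).indicator (fun _ => 1) z) := by
        rw [lintegral_lintegral_swap]
        exact ((hg.comp measurable_fst).mul (hK.comp measurable_swap)).aemeasurable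
    _ ≤ 2 * ∫⁻ p in Q', wLq q h p := by
        refine mul_le_mul_right (setLIntegral_mono' hQ' fun p hp => ?_) _
        refine le_trans (le_of_eq ?_) (average_le_wLq hq hm hp.1.1)
        have hB : MeasurableSet (wBox p) := measurableSet_Ioo.prod measurableSet_Ioo
        rw [← lintegral_indicator hB, ← lintegral_const_mul _ (hg.indicator hB)]
        refine lintegral_congr fun z => ?_
        by_cases hz : z ∈ wBox p <;> simp [hz, mul_comm]

lemma carlE_le_eight_mul_carlE_wLq {q : ℝ} (hq : 1 ≤ q) {h : ℝ × ℝ → ℝ} (hm : Measurable h)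
    (x : ℝ) : carlE (fun w => ENNReal.ofReal |h w|) x ≤ 8 * carlE (wLq q h) x := by
  refine iSup_le fun a => iSup_le fun ℓ => iSup_le fun hℓ => iSup_le fun hx => ?_
  have hmem : x ∈ Set.Ico (a - ℓ) (a - ℓ + 4 * ℓ) := ⟨by linarith [hx.1], by linarith [hx.2]⟩
  have h4 : 0 < 4 * ℓ := by positivity
  have key : (ENNReal.ofReal (4 * ℓ))⁻¹ *
      ∫⁻ p in Set.Ioo 0 (4 * ℓ) ×ˢ Set.Ico (a - ℓ) (a - ℓ + 4 * ℓ), wLq q h p ≤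
      carlE (wLq q h) x :=
    le_iSup_of_le (a - ℓ) <| le_iSup_of_le (4 * ℓ) <| le_iSup_of_le h4 <|
      le_iSup_of_le hmem le_rfl
  rw [ENNReal.inv_mul_le_iff (by rwa [ENNReal.ofReal_ne_zero_iff]) ENNReal.ofReal_ne_top] at key ⊢
  calc _ ≤ _ := lintegral_le_two_mul_lintegral_wLq hq hm a ℓ
    _ ≤ 2 * (ENNReal.ofReal (4 * ℓ) * carlE (wLq q h) x) := by gcongr
    _ = _ := by
      rw [ENNReal.ofReal_mul (by norm_num), ENNReal.ofReal_ofNat]; ring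

lemma exists_lintegral_carlE_wLq_fH_le {p q : ℝ} (hp : 1 < p) (hq : 0 < q) :
    ∃ K : ℝ, 0 ≤ K ∧ ∀ N : ℕ, ∫⁻ x, carlE (wLq q (fH N)) x ^ p ≤
      ENNReal.ofReal (135 * ((N : ℝ) + 1)) ^ p * ENNReal.ofReal K := by
  have hfin : ∫⁻ x : ℝ, ENNReal.ofReal ((1 + |x|)⁻¹) ^ p < ∞ := by
    have := finite_integral_one_add_norm (E := ℝ) (μ := volume) (r := p) (by simpa using hp)
    refine lt_of_le_of_lt (le_of_eq (lintegral_congr fun x => ?_)) this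
    rw [ENNReal.ofReal_rpow_of_nonneg (by positivity) (by linarith), Real.inv_rpow (by positivity),
      Real.rpow_neg (by positivity), Real.norm_eq_abs]
  refine ⟨(∫⁻ x : ℝ, ENNReal.ofReal ((1 + |x|)⁻¹) ^ p).toReal, ENNReal.toReal_nonneg,
    fun N => ?_⟩
  rw [ENNReal.ofReal_toReal hfin.ne, ← lintegral_const_mul _ (by fun_prop)]
  refine lintegral_mono fun x => ?_
  rw [← ENNReal.mul_rpow_of_nonneg _ _ (by linarith)]
  refine ENNReal.rpow_le_rpow (carlE_le_of_le_fMaj (fun w hw => ?_) x) (by linarith)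
  exact wLq_le_of_forall_le hq hw fun z hz => ofReal_abs_fH_le_fMaj hz

/-- For `f_N` the Whitney-supremum Carleson bound `C(W_∞ f_N) ≲ N` holds on `[0,1]`.
Combined with the lower bound `C(H f_N) ≳ N²` on `(0,1)` (here a hypothesis on the
horizontal Hilbert transforms `HfN N = H f_N`), this shows that the horizontally acting
Hilbert transform is unbounded in the norms `‖C(W_q f)‖_p` for all `1 < p, q < ∞`. -/
theorem horizontal_hilbert_unbounded (c₀ : ℝ) (hc₀ : 0 < c₀)
    (HfN : ℕ → ℝ × ℝ → ℝ) (hmeas : ∀ N, Measurable (HfN N))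
    (hlow : ∀ (N : ℕ), ∀ x ∈ Set.Ioo (0 : ℝ) 1,
      ENNReal.ofReal (c₀ * (N : ℝ) ^ 2) ≤
        carlE (fun w => ENNReal.ofReal |HfN N w|) x) :
    (∃ c : ℝ, 0 < c ∧ ∀ (N : ℕ), ∀ x ∈ Set.Icc (0 : ℝ) 1,
      carlE (wInf (fH N)) x ≤ ENNReal.ofReal (c * ((N : ℝ) + 1))) ∧
    (∀ p q : ℝ, 1 < p → 1 < q →
      ¬ ∃ A : ℝ, 0 ≤ A ∧ ∀ N : ℕ,
        (∫⁻ x, carlE (wLq q (HfN N)) x ^ p) ≤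
          ENNReal.ofReal A * ∫⁻ x, carlE (wLq q (fH N)) x ^ p) := by
  refine ⟨⟨135, by norm_num, fun N x _ => ?_⟩, ?_⟩
  · refine (carlE_le_of_le_fMaj (fun w _ => wInf_fH_le_fMaj N w) x).trans ?_
    refine mul_le_of_le_one_right' ?_
    rw [ENNReal.ofReal_le_one]
    exact inv_le_one_of_one_le₀ (by linarith [abs_nonneg x])
  · rintro p q hp hq ⟨A, hA, hbd⟩
    have hp0 : 0 < p := by linarith
    obtain ⟨K, hK, hup⟩ := exists_lintegral_carlE_wLq_fH_le hp (zero_lt_one.trans hq)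
    have hlo : ∀ N : ℕ, ENNReal.ofReal (c₀ * (N : ℝ) ^ 2 / 8) ^ p ≤
        ∫⁻ x, carlE (wLq q (HfN N)) x ^ p := by
      intro N
      calc _ = ∫⁻ _ in Set.Ioo (0 : ℝ) 1, ENNReal.ofReal (c₀ * (N : ℝ) ^ 2 / 8) ^ p := by
            simp [Real.volume_Ioo]
        _ ≤ ∫⁻ x in Set.Ioo (0 : ℝ) 1, carlE (wLq q (HfN N)) x ^ p := by
            refine setLIntegral_mono' measurableSet_Ioo fun x hx => ?_
            refine ENNReal.rpow_le_rpow ?_ hp0.le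
            rw [ENNReal.ofReal_div_of_pos (by norm_num), ENNReal.ofReal_ofNat]
            refine ENNReal.div_le_of_le_mul' ?_
            exact (hlow N x hx).trans (carlE_le_eight_mul_carlE_wLq hq.le (hmeas N) x)
        _ ≤ _ := setLIntegral_le_lintegral _ _
    have hreal : ∀ N : ℕ, c₀ * (N : ℝ) ^ 2 / 8 ≤ 135 * ((N : ℝ) + 1) * (A * K) ^ (1 / p) := by
      intro N
      have h := (hlo N).trans ((hbd N).trans (mul_le_mul_right (hup N) _))
      rw [ENNReal.ofReal_rpow_of_nonneg (by positivity) hp0.le,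
        ENNReal.ofReal_rpow_of_nonneg (by positivity) hp0.le, ← ENNReal.ofReal_mul (by positivity),
        ← ENNReal.ofReal_mul hA, ENNReal.ofReal_le_ofReal_iff (by positivity)] at h
      rw [← Real.rpow_le_rpow_iff (by positivity) (by positivity) hp0,
        Real.mul_rpow (x := 135 * ((N : ℝ) + 1)) (by positivity) (by positivity),
        ← Real.rpow_mul (by positivity), one_div_mul_cancel hp0.ne', Real.rpow_one]
      linarith
    obtain ⟨n, hn⟩ := exists_nat_gt (2160 * (A * K) ^ (1 / p) / c₀)
    have h := hreal (n + 1)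
    rw [div_lt_iff₀ hc₀] at hn
    have hB : 0 ≤ (A * K) ^ (1 / p) := by positivity
    push_cast at h
    nlinarith [mul_nonneg hB (Nat.cast_nonneg (α := ℝ) n), Nat.cast_nonneg (α := ℝ) n]
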